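/- arXiv:2307.14704 — 3 statements merged into one kernel-verified Lean document; each statement's English description precedes it below -/
import Mathlib

section
/- Let F be a field, W an n-dimensional vector space over F, and a, b positive integers. Suppose U_1,...,U_m are a-dimensional subspaces of W and V_1,...,V_m are b-dimensional subspaces of W such that U_i ∩ V_i = {0} for all i and dim(U_i ∩ V_j) > 0 for all 1 ≤ i < j ≤ m. Then m ≤ C(a+b, a). -/
/-- A triangular system of values of determinants bounds the number of families. -/
theorem skew_det_bound {R : Type*} [CommRing R] [IsDomain R] (m a b : ℕ)
    (u : Fin m → Fin a → (Fin b ⊕ Fin a → R)) (v : Fin m → Fin b → (Fin b ⊕ Fin a → R))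
    (hdiag : ∀ i, Matrix.det (Matrix.of (Sum.elim (v i) (u i))) ≠ 0)
    (hskew : ∀ i j, i < j → Matrix.det (Matrix.of (Sum.elim (v j) (u i))) = 0) :
    m ≤ (a + b).choose a := by
  classical
  let M := Fin b ⊕ Fin a → R
  let φ : Fin m → (M [⋀^Fin a]→ₗ[R] R) := fun j =>
    { MultilinearMap.currySum
        (Matrix.detRowAlternating (n := Fin b ⊕ Fin a) (R := R)).toMultilinearMap (v j) with
      map_eq_zero_of_eq' := by
        intro w k l hkl hne
        exact (Matrix.detRowAlternating (n := Fin b ⊕ Fin a) (R := R)).map_eq_zero_of_eq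
          (Sum.elim (v j) w) (i := Sum.inr k) (j := Sum.inr l) hkl (by simpa using hne) }
  have hφ : ∀ j w, φ j w = Matrix.det (Matrix.of (Sum.elim (v j) w)) := fun j w => rfl
  let x : Fin m → ⋀[R]^a M := fun i => exteriorPower.ιMulti R a (u i)
  let L : ⋀[R]^a M →ₗ[R] (Fin m → R) :=
    LinearMap.pi fun j => exteriorPower.alternatingMapLinearEquiv (φ j)
  let A : Matrix (Fin m) (Fin m) R := Matrix.of fun i j => φ j (u i)
  have hA : A.det ≠ 0 := by
    rw [Matrix.det_of_isLowerTriangular]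
    · exact Finset.prod_ne_zero_iff.2 fun i _ => by simpa [A, hφ] using hdiag i
    · intro i j hij
      exact hskew i j (by simpa using hij)
  have hx : LinearIndependent R x := by
    apply LinearIndependent.of_comp L
    convert Matrix.linearIndependent_rows_of_det_ne_zero hA using 1
    funext i j
    simp [L, x, A]
  have := hx.fintype_card_le_finrank
  rw [exteriorPower.finrank_eq] at this
  simpa [M, add_comm] using this

theorem lovasz_skew_subspaces (F : Type*) [Field F] (W : Type*) [AddCommGroup W]
    [Module F W] [FiniteDimensional F W] (n m a b : ℕ)
    (hn : Module.finrank F W = n) (ha : 0 < a) (hb : 0 < b)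
    (U V : Fin m → Submodule F W)
    (hU : ∀ i, Module.finrank F (U i) = a) (hV : ∀ i, Module.finrank F (V i) = b)
    (hself : ∀ i, U i ⊓ V i = ⊥)
    (hskew : ∀ i j, i < j → 0 < Module.finrank F ↥(U i ⊓ V j)) :
    m ≤ (a + b).choose a := by
  classical
  let B := Module.finBasis F W
  let R := MvPolynomial ((Fin b ⊕ Fin a) × Fin (Module.finrank F W)) F
  -- the generic projection
  let g : W →ₗ[F] (Fin b ⊕ Fin a → R) :=
    LinearMap.pi fun k => B.constr F fun t => (MvPolynomial.X (k, t) : R)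
  let u0 : ∀ i, Module.Basis (Fin a) F (U i) := fun i => Module.finBasisOfFinrankEq F (U i) (hU i)
  let v0 : ∀ i, Module.Basis (Fin b) F (V i) := fun i => Module.finBasisOfFinrankEq F (V i) (hV i)
  let u : Fin m → Fin a → W := fun i k => (u0 i k : W)
  let v : Fin m → Fin b → W := fun i k => (v0 i k : W)
  have hui : ∀ i, LinearIndependent F (u i) := fun i =>
    (u0 i).linearIndependent.map' (U i).subtype (Submodule.ker_subtype _)
  have hvi : ∀ i, LinearIndependent F (v i) := fun i =>
    (v0 i).linearIndependent.map' (V i).subtype (Submodule.ker_subtype _)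
  have hus : ∀ i, Submodule.span F (Set.range (u i)) = U i := fun i => by
    have : Set.range (u i) = (U i).subtype '' Set.range (u0 i) := by
      rw [← Set.range_comp]; rfl
    rw [this, Submodule.span_image, (u0 i).span_eq, Submodule.map_subtype_top]
  have hvs : ∀ i, Submodule.span F (Set.range (v i)) = V i := fun i => by
    have : Set.range (v i) = (V i).subtype '' Set.range (v0 i) := by
      rw [← Set.range_comp]; rfl
    rw [this, Submodule.span_image, (v0 i).span_eq, Submodule.map_subtype_top]
  have hcomp : ∀ i j, Sum.elim (fun k => g (v j k)) (fun k => g (u i k))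
      = fun k => g (Sum.elim (v j) (u i) k) := fun i j => by
    funext k; cases k <;> rfl
  refine skew_det_bound (R := R) m a b (fun i k => g (u i k)) (fun i k => g (v i k)) ?_ ?_
  · intro i
    rw [hcomp]
    have hli : LinearIndependent F (Sum.elim (v i) (u i)) := by
      refine (hvi i).sum_type (hui i) ?_
      rw [hus, hvs, disjoint_iff, inf_comm, hself]
    obtain ⟨f, hf⟩ := LinearMap.exists_leftInverse_of_injective
      (Fintype.linearCombination F (Sum.elim (v i) (u i)))
      (LinearMap.ker_eq_bot.2 (hli.fintypeLinearCombination_injective))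
    have hf1 : ∀ k, f (Sum.elim (v i) (u i) k) = Pi.single k 1 := fun k => by
      have := LinearMap.congr_fun hf (Pi.single k 1)
      simpa [Fintype.linearCombination_apply_single] using this
    let e : R →ₐ[F] F := MvPolynomial.aeval fun p => f (B p.2) p.1
    have he : ∀ w k, e (g w k) = f w k := by
      intro w k
      have : e.toLinearMap ∘ₗ (LinearMap.proj k).comp g = (LinearMap.proj k).comp f := by
        apply B.ext
        intro t
        simp only [LinearMap.comp_apply, LinearMap.proj_apply, g, LinearMap.pi_apply,
          Module.Basis.constr_basis]
        exact MvPolynomial.aeval_X _ _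
      exact LinearMap.congr_fun this w
    intro h0
    have h1 := congrArg e h0
    rw [AlgHom.map_det, map_zero] at h1
    have : e.mapMatrix (Matrix.of fun k => g (Sum.elim (v i) (u i) k)) = 1 := by
      ext k l
      rw [AlgHom.mapMatrix_apply, Matrix.map_apply, Matrix.of_apply, he, hf1, Matrix.one_apply,
        Pi.single_apply]
      simp [eq_comm]
    rw [this, Matrix.det_one] at h1
    exact one_ne_zero h1
  · intro i j hij
    rw [hcomp]
    have hnd : ¬ LinearIndependent F (Sum.elim (v j) (u i)) := by
      intro h
      have h2 := (linearIndependent_sum.1 h).2.2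
      simp only [Sum.elim_comp_inl, Sum.elim_comp_inr, hus, hvs] at h2
      have h3 := hskew i j hij
      rw [inf_comm, disjoint_iff.1 h2] at h3
      simp at h3
    obtain ⟨c, hc, k, hk⟩ := Fintype.not_linearIndependent_iff.1 hnd
    rw [← Matrix.exists_vecMul_eq_zero_iff]
    refine ⟨fun k => MvPolynomial.C (c k), fun h => hk ?_, ?_⟩
    · simpa using congrFun h k
    · have := congrArg g hc
      rw [map_sum, map_zero] at this
      funext l
      have h4 := congrFun this l
      have h5 : ∀ (d : F) (p : R), MvPolynomial.C d * p = d • p := fun d p =>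
        (MvPolynomial.smul_eq_C_mul p d).symm
      simpa [Matrix.vecMul, dotProduct, h5] using h4
end

section
/- Let W be an n-dimensional vector space over an arbitrary field F and let t be an integer with 0 ≤ t ≤ n. Suppose U_1,...,U_m and V_1,...,V_m are subspaces of W such that dim(U_i ∩ V_i) ≤ t for all 1 ≤ i ≤ m and dim(U_i ∩ V_j) > t for all 1 ≤ i < j ≤ m. Then m ≤ 2^{n-t}. -/
/-- Triangular families of vectors are linearly independent. -/
lemma skew_aux_triangular {K E ι : Type*} [Field K] [AddCommGroup E] [Module K E]
    [Fintype ι] [LinearOrder ι] (u : ι → E) (φ : ι → E →ₗ[K] K)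
    (h1 : ∀ i, φ i (u i) ≠ 0) (h2 : ∀ i j, i < j → φ j (u i) = 0) :
    LinearIndependent K u := by
  classical
  rw [Fintype.linearIndependent_iff]
  intro g hg
  by_contra! hne
  obtain ⟨i0, hi0⟩ := hne
  let S : Finset ι := Finset.univ.filter (fun i => g i ≠ 0)
  have hS : S.Nonempty := ⟨i0, by simp [S, hi0]⟩
  have hmem := S.max'_mem hS
  set j := S.max' hS with hj
  have hgj : g j ≠ 0 := by simpa [S] using hmem
  have hz : φ j (∑ i, g i • u i) = 0 := by rw [hg, map_zero]
  rw [map_sum, Finset.sum_eq_single j] at hz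
  · rw [map_smul, smul_eq_mul, mul_eq_zero] at hz
    exact hz.elim hgj (h1 j)
  · intro i _ hij
    rw [map_smul]
    rcases lt_or_gt_of_ne hij with h | h
    · rw [h2 i j h, smul_zero]
    · have : g i = 0 := by
        by_contra hgi
        have : i ≤ j := S.le_max' i (by simp [S, hgi])
        exact absurd this (not_le.mpr h)
      rw [this, zero_smul]
  · simp

/-- The skew theorem for `t = 0` and subspaces `U i` of fixed dimension `k`. -/
lemma skew_aux_fixed {K W ι : Type*} [Field K] [AddCommGroup W] [Module K W]
    [FiniteDimensional K W] [Fintype ι] [LinearOrder ι] (k : ℕ) (U V : ι → Submodule K W)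
    (hk : ∀ i, Module.finrank K (U i) = k)
    (h1 : ∀ i, Disjoint (U i) (V i)) (h2 : ∀ i j, i < j → ¬ Disjoint (U i) (V j)) :
    Fintype.card ι ≤ (Module.finrank K W).choose k := by
  classical
  have hV : ∀ i, ∃ V' : Submodule K W, V i ≤ V' ∧ IsCompl (U i) V' := fun i => by
    obtain ⟨V', h, h'⟩ := (h1 i).symm.exists_isCompl
    exact ⟨V', h, h'.symm⟩
  choose V' hle hc using hV
  let b : ∀ i, Module.Basis (Fin k) K (U i) := fun i => Module.finBasisOfFinrankEq K (U i) (hk i)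
  let f : ∀ i, W [⋀^Fin k]→ₗ[K] K := fun i =>
    (b i).det.compLinearMap ((U i).projectionOnto (V' i) (hc i))
  have hli := skew_aux_triangular (K := K)
    (fun i => exteriorPower.ιMulti K k (fun a => ((b i a : U i) : W)))
    (fun i => exteriorPower.alternatingMapLinearEquiv (f i)) ?_ ?_
  · rw [← exteriorPower.finrank_eq]
    exact hli.fintype_card_le_finrank
  · intro i
    rw [exteriorPower.alternatingMapLinearEquiv_apply_ιMulti]
    have : f i (fun a => ((b i a : U i) : W)) = (b i).det (b i) := by
      simp only [f, AlternatingMap.compLinearMap_apply]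
      congr 1
      ext a
      simp
    rw [this, Module.Basis.det_self]
    exact one_ne_zero
  · intro i j hij
    rw [exteriorPower.alternatingMapLinearEquiv_apply_ιMulti]
    simp only [f, AlternatingMap.compLinearMap_apply]
    apply AlternatingMap.map_linearDependent
    intro hl
    apply h2 i j hij
    rw [Submodule.disjoint_def]
    intro x hxU hxV
    rw [Fintype.linearIndependent_iff] at hl
    have hx := (b i).sum_repr ⟨x, hxU⟩
    have hx' : ∑ a, (b i).repr ⟨x, hxU⟩ a • ((b i a : U i) : W) = x := by
      have h := congrArg (U i).subtype hx
      rw [map_sum] at h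
      exact h
    have h0 : (U j).projectionOnto (V' j) (hc j) x = 0 :=
      ((U j).projectionOnto_apply_eq_zero_iff (hc j)).mpr (hle j hxV)
    have := hl ((b i).repr ⟨x, hxU⟩) (by
      rw [← hx', map_sum] at h0
      simpa only [map_smul] using h0)
    rw [← hx']
    exact Finset.sum_eq_zero fun a _ => by rw [this a, zero_smul]

/-- The skew theorem for `t = 0`. -/
lemma skew_aux_zero {K W : Type*} [Field K] [AddCommGroup W] [Module K W]
    [FiniteDimensional K W] {m : ℕ} (U V : Fin m → Submodule K W)
    (h1 : ∀ i, Disjoint (U i) (V i)) (h2 : ∀ i j, i < j → ¬ Disjoint (U i) (V j)) :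
    m ≤ 2 ^ (Module.finrank K W) := by
  classical
  rw [← Nat.sum_range_choose]
  have hm : m = (Finset.univ : Finset (Fin m)).card := by simp
  conv_lhs => rw [hm]
  rw [Finset.card_eq_sum_card_fiberwise (f := fun i => Module.finrank K (U i))
    (t := Finset.range (Module.finrank K W + 1))]
  · apply Finset.sum_le_sum
    intro k _
    have := skew_aux_fixed (ι := {i : Fin m // Module.finrank K (U i) = k}) k
      (fun i => U i) (fun i => V i) (fun i => i.2) (fun i => h1 i) (fun i j h => h2 i j h)
    rwa [Fintype.card_subtype] at this
  · intro i _
    simpa [Nat.lt_succ_iff] using Submodule.finrank_le (U i)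

/-- General position over an infinite field. -/
lemma skew_aux_generic {K W : Type*} [Field K] [Infinite K] [AddCommGroup W] [Module K W]
    [FiniteDimensional K W] {m : ℕ} (hm : 0 < m) (d : ℕ) : ∀ (t : ℕ), t + d = Module.finrank K W →
    ∀ S : Fin m → Submodule K W, (∀ i, Module.finrank K (S i) ≤ t) →
    ∃ P : Submodule K W, Module.finrank K P = d ∧ ∀ i, Disjoint P (S i) := by
  induction d with
  | zero => exact fun t _ S _ => ⟨⊥, by simp, fun i => disjoint_bot_left⟩
  | succ d ih =>
    intro t ht S hS
    obtain ⟨x, hx0, hx⟩ : ∃ x : W, x ≠ 0 ∧ ∀ i, x ∉ S i := by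
      by_contra! hcon
      have hcov : ⋃ i : Option (Fin m),
          ((i.elim ⊥ S : Subspace K W) : Set W) = Set.univ := by
        rw [Set.iUnion_eq_univ_iff]
        intro x
        by_cases hx : x = 0
        · exact ⟨none, by simp [hx]⟩
        · obtain ⟨i, hi⟩ := hcon x hx
          exact ⟨some i, hi⟩
      obtain ⟨i, hi⟩ := Subspace.exists_eq_top_of_iUnion_eq_univ hcov
      have hf : Module.finrank K (i.elim ⊥ S : Submodule K W) = Module.finrank K W := by
        rw [hi]; exact finrank_top K W
      cases i with
      | none =>
        have hf' : Module.finrank K (⊥ : Submodule K W) = Module.finrank K W := hf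
        rw [finrank_bot] at hf'
        omega
      | some i =>
        have := hS i
        have hf' : Module.finrank K (S i) = Module.finrank K W := hf
        omega
    have hspan : Module.finrank K (Submodule.span K {x}) = 1 := finrank_span_singleton hx0
    obtain ⟨P, hP, hdis⟩ := ih (t + 1) (by omega) (fun i => Submodule.span K {x} ⊔ S i) (by
        intro i
        have := Submodule.finrank_add_le_finrank_add_finrank (Submodule.span K {x}) (S i)
        have := hS i
        omega)
    refine ⟨P ⊔ Submodule.span K {x}, ?_, fun i => ?_⟩
    · have hd : P ⊓ Submodule.span K {x} = ⊥ :=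
        ((hdis ⟨0, hm⟩).mono_right le_sup_left).eq_bot
      have := Submodule.finrank_sup_add_finrank_inf_eq P (Submodule.span K {x})
      rw [hd, finrank_bot] at this
      omega
    · refine Disjoint.disjoint_sup_left_of_disjoint_sup_right ?_ (hdis i)
      rw [disjoint_comm]
      exact (Submodule.disjoint_span_singleton' hx0).mpr (hx i)

/-- The skew theorem over an infinite field. -/
lemma skew_aux_infinite {K W : Type*} [Field K] [Infinite K] [AddCommGroup W] [Module K W]
    [FiniteDimensional K W] {m t : ℕ} (ht : t ≤ Module.finrank K W)
    (U V : Fin m → Submodule K W)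
    (hself : ∀ i, Module.finrank K ↥(U i ⊓ V i) ≤ t)
    (hskew : ∀ i j, i < j → t < Module.finrank K ↥(U i ⊓ V j)) :
    m ≤ 2 ^ (Module.finrank K W - t) := by
  rcases Nat.eq_zero_or_pos m with hm | hm
  · rw [hm]; exact Nat.zero_le _
  obtain ⟨P, hP, hd⟩ := skew_aux_generic (K := K) (W := W) hm (Module.finrank K W - t) t
    (by omega) (fun i => U i ⊓ V i) hself
  rw [← hP]
  apply skew_aux_zero (fun i => (U i).comap P.subtype) (fun i => (V i).comap P.subtype)
  · intro i
    rw [Submodule.disjoint_def]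
    intro x hxU hxV
    have := (Submodule.disjoint_def.mp (hd i)) x x.2 ⟨hxU, hxV⟩
    exact Subtype.ext this
  · intro i j hij hdis
    have hb : P ⊓ (U i ⊓ V j) = ⊥ := by
      rw [eq_bot_iff]
      rintro x ⟨hxP, hxU, hxV⟩
      have := (Submodule.disjoint_def.mp hdis) ⟨x, hxP⟩ hxU hxV
      simpa using congrArg Subtype.val this
    have h := Submodule.finrank_sup_add_finrank_inf_eq P (U i ⊓ V j)
    rw [hb, finrank_bot] at h
    have := Submodule.finrank_le (P ⊔ (U i ⊓ V j))
    have := hskew i j hij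
    omega

lemma skew_aux_finrank {F K W : Type*} [Field F] [Field K] [Algebra F K] [AddCommGroup W]
    [Module F W] (p : Submodule F W) :
    Module.finrank K (p.baseChange K) = Module.finrank F p := by
  rw [← (Submodule.toBaseChange.toLinearEquiv K p).finrank_eq, Module.finrank_baseChange]

lemma skew_aux_inf {F K W : Type*} [Field F] [Field K] [Algebra F K] [AddCommGroup W]
    [Module F W] [FiniteDimensional F W] (p q : Submodule F W) :
    Module.finrank K ↥(p.baseChange K ⊓ q.baseChange K) = Module.finrank F ↥(p ⊓ q) := by
  have hs : (p ⊔ q).baseChange K = p.baseChange K ⊔ q.baseChange K := by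
    apply le_antisymm
    · rw [Submodule.baseChange_eq_span, Submodule.span_le]
      rintro _ ⟨x, hx, rfl⟩
      obtain ⟨y, hy, z, hz, rfl⟩ := Submodule.mem_sup.mp hx
      rw [map_add]
      exact add_mem
        (Submodule.mem_sup_left (Submodule.tmul_mem_baseChange_of_mem 1 hy))
        (Submodule.mem_sup_right (Submodule.tmul_mem_baseChange_of_mem 1 hz))
    · exact sup_le (Submodule.baseChange_mono K le_sup_left) (Submodule.baseChange_mono K le_sup_right)
  have h1 := Submodule.finrank_sup_add_finrank_inf_eq p q
  have h2 := Submodule.finrank_sup_add_finrank_inf_eq (p.baseChange K) (q.baseChange K)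
  rw [← hs, skew_aux_finrank, skew_aux_finrank, skew_aux_finrank] at h2
  omega

theorem skew_t_subspaces (F : Type*) [Field F] (W : Type*) [AddCommGroup W]
    [Module F W] [FiniteDimensional F W] (n m t : ℕ)
    (hn : Module.finrank F W = n) (ht : t ≤ n)
    (U V : Fin m → Submodule F W)
    (hself : ∀ i, Module.finrank F ↥(U i ⊓ V i) ≤ t)
    (hskew : ∀ i j, i < j → t < Module.finrank F ↥(U i ⊓ V j)) :
    m ≤ 2 ^ (n - t) := by
  subst hn
  let K := AlgebraicClosure F
  have : Infinite K := IsAlgClosed.instInfinite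
  have hW : Module.finrank K (TensorProduct F K W) = Module.finrank F W :=
    Module.finrank_baseChange
  rw [← hW] at ht ⊢
  exact skew_aux_infinite ht (fun i => (U i).baseChange K) (fun i => (V i).baseChange K)
    (fun i => by rw [skew_aux_inf]; exact hself i)
    (fun i j h => by rw [skew_aux_inf]; exact hskew i j h)
end

section
/- Let t ≥ 0 and let {(A_i, B_i)}_{1≤i≤m} be a skew Bollobás t-system of subsets of [n], i.e., |A_i ∩ B_i| ≤ t for all i and |A_i ∩ B_j| > t for all 1 ≤ i < j ≤ m. Then m ≤ 2^{n-t}. -/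
lemma wedge_ne_zero {K E : Type*} [Field K] [AddCommGroup E] [Module K E] {k : ℕ}
    {v : Fin k → E} (hv : LinearIndependent K v) : ExteriorAlgebra.ιMulti K k v ≠ 0 := by
  have h := (exteriorPower.ιMulti_family_linearIndependent_field k hv).ne_zero
    (Set.powersetCard.ofFinEmbEquiv (RelEmbedding.refl _))
  intro h0
  apply h
  apply Subtype.ext
  simp only [exteriorPower.ιMulti_family, Equiv.symm_apply_apply]
  exact h0

lemma subspace_skew {K E : Type*} [Field K] [AddCommGroup E] [Module K E] [FiniteDimensional K E]
    (m : ℕ) (U V : Fin m → Submodule K E) (h1 : ∀ i, Disjoint (U i) (V i))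
    (h2 : ∀ i j, i < j → ¬ Disjoint (U i) (V j)) : m ≤ 2 ^ Module.finrank K E := by
  classical
  let bU := fun i => Module.finBasis K (U i)
  let bV := fun i => Module.finBasis K (V i)
  let u := fun i => fun k => ((bU i k : U i) : E)
  let v := fun i => fun k => ((bV i k : V i) : E)
  have liU : ∀ i, LinearIndependent K (u i) := fun i =>
    (bU i).linearIndependent.map' (U i).subtype (Submodule.ker_subtype _)
  have liV : ∀ i, LinearIndependent K (v i) := fun i =>
    (bV i).linearIndependent.map' (V i).subtype (Submodule.ker_subtype _)
  have spU : ∀ i, Submodule.span K (Set.range (u i)) = U i := fun i => by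
    have := congrArg (Submodule.map (U i).subtype) (bU i).span_eq
    rw [Submodule.map_span, ← Set.range_comp, Submodule.map_subtype_top] at this
    exact this
  have spV : ∀ i, Submodule.span K (Set.range (v i)) = V i := fun i => by
    have := congrArg (Submodule.map (V i).subtype) (bV i).span_eq
    rw [Submodule.map_span, ← Set.range_comp, Submodule.map_subtype_top] at this
    exact this
  have key : ∀ i j, LinearIndependent K (Fin.append (u i) (v j)) ↔ Disjoint (U i) (V j) := by
    intro i j
    rw [← linearIndependent_equiv finSumFinEquiv, linearIndependent_sum]
    have e1 : (Fin.append (u i) (v j) ∘ finSumFinEquiv) ∘ Sum.inl = u i := by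
      ext k; simp
    have e2 : (Fin.append (u i) (v j) ∘ finSumFinEquiv) ∘ Sum.inr = v j := by
      ext k; simp
    rw [e1, e2, spU, spV]
    simp [liU, liV]
  let x := fun i => ExteriorAlgebra.ιMulti K _ (u i)
  let y := fun i => ExteriorAlgebra.ιMulti K _ (v i)
  let B := (Module.finBasis K E).ExteriorAlgebra
  haveI : Module.Finite K (ExteriorAlgebra K E) := Module.Finite.of_basis B
  have hd : ∀ i, x i * y i ≠ 0 := fun i => by
    simp only [x, y, ExteriorAlgebra.ιMulti_mul_ιMulti]
    exact wedge_ne_zero ((key i i).2 (h1 i))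
  have hz : ∀ i j, i < j → x i * y j = 0 := fun i j hij => by
    simp only [x, y, ExteriorAlgebra.ιMulti_mul_ιMulti]
    have := Module.Free.of_basis B
    exact AlternatingMap.map_linearDependent _ _ (fun h => h2 i j hij ((key i j).1 h))
  have li : LinearIndependent K x := by
    rw [Fintype.linearIndependent_iff]
    intro g hg
    by_contra! hne
    have hS : (Finset.univ.filter fun i => g i ≠ 0).Nonempty := by
      obtain ⟨i, hi⟩ := hne
      exact ⟨i, by simpa using hi⟩
    obtain ⟨j, hj, hmax⟩ := Finset.exists_max_image _ id hS
    have hj' : g j ≠ 0 := by simpa using hj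
    have := congrArg (· * y j) hg
    simp only [Finset.sum_mul, zero_mul, smul_mul_assoc] at this
    rw [Finset.sum_eq_single j] at this
    · exact (smul_ne_zero hj' (hd j)) this
    · intro i _ hij
      rcases lt_or_gt_of_ne hij with h | h
      · rw [hz i j h, smul_zero]
      · have : g i = 0 := by
          by_contra hi
          exact absurd (hmax i (by simpa using hi)) (not_le.2 h)
        rw [this, zero_smul]
    · simp
  have := li.fintype_card_le_finrank
  rw [Module.finrank_eq_card_basis B] at this
  simpa using this

open Polynomial in
theorem skew_aux (n t : ℕ) (S : Finset (Fin n)) :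
    (S.card ≤ t → ∀ p ∈ degreeLT ℚ (n - t), (∀ k ∉ S, p.eval ((k : ℕ) : ℚ) = 0) → p = 0) ∧
    (t < S.card → ∃ p ∈ degreeLT ℚ (n - t), (∀ k ∉ S, p.eval ((k : ℕ) : ℚ) = 0) ∧ p ≠ 0) := by
  have hc : Sᶜ.card = n - S.card := by simp [Finset.card_compl]
  have hle : S.card ≤ n := by simpa using Finset.card_le_univ S
  have hinj : Function.Injective (fun k : Fin n => ((k : ℕ) : ℚ)) := fun a b h => by
    simpa [Fin.ext_iff] using h
  constructor
  · intro hS p hp hk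
    refine Polynomial.eq_zero_of_degree_lt_of_eval_index_eq_zero (s := Sᶜ)
      (v := fun k : Fin n => ((k : ℕ) : ℚ)) hinj.injOn ?_ (fun k hk' => hk k (by simpa using hk'))
    refine (mem_degreeLT.1 hp).trans_le ?_
    rw [hc]
    exact_mod_cast (by omega : n - t ≤ n - S.card)
  · intro hS
    refine ⟨∏ k ∈ Sᶜ, (X - C ((k : ℕ) : ℚ)), ?_, ?_, ?_⟩
    · rw [mem_degreeLT, degree_prod]
      simp only [degree_X_sub_C, Finset.sum_const, hc]
      rw [nsmul_one]
      exact_mod_cast (by omega : n - S.card < n - t)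
    · intro k hk
      rw [eval_prod]
      exact Finset.prod_eq_zero (i := k) (by simpa using hk) (by simp)
    · exact Finset.prod_ne_zero_iff.2 fun k _ => X_sub_C_ne_zero _

open Polynomial in
/-- Polynomials of degree below `d` vanishing at the points outside `S`. -/
noncomputable def vanishOff (n d : ℕ) (S : Finset (Fin n)) : Submodule ℚ (degreeLT ℚ d) where
  carrier := {p | ∀ k ∉ S, (p : ℚ[X]).eval ((k : ℕ) : ℚ) = 0}
  add_mem' := fun ha hb k hk => by simp [ha k hk, hb k hk]
  zero_mem' := fun k _ => by simp
  smul_mem' := fun c p hp k hk => by simp [hp k hk]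

theorem vanishOff_disjoint (n t : ℕ) (S T : Finset (Fin n)) :
    Disjoint (vanishOff n (n - t) S) (vanishOff n (n - t) T) ↔ (S ∩ T).card ≤ t := by
  rw [Submodule.disjoint_def]
  constructor
  · intro h
    by_contra! hc
    obtain ⟨p, hp, hk, h0⟩ := (skew_aux n t (S ∩ T)).2 hc
    refine h0 (congrArg Subtype.val (h ⟨p, hp⟩ ?_ ?_))
    · exact fun k hk' => hk k (by simp [hk'])
    · exact fun k hk' => hk k (by simp [hk'])
  · intro hc p h1 h2
    refine Subtype.ext ((skew_aux n t (S ∩ T)).1 hc p p.2 fun k hk => ?_)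
    by_cases hS : k ∈ S
    · exact h2 k (fun hT => hk (by simp [hS, hT]))
    · exact h1 k hS

theorem skew_t_system_bound (n m t : ℕ) (A B : Fin m → Finset (Fin n))
    (hself : ∀ i, (A i ∩ B i).card ≤ t)
    (hskew : ∀ i j, i < j → t < (A i ∩ B j).card) :
    m ≤ 2 ^ (n - t) := by
  haveI : FiniteDimensional ℚ (Polynomial.degreeLT ℚ (n - t)) :=
    Module.Finite.equiv (Polynomial.degreeLTEquiv ℚ (n - t)).symm
  have h := subspace_skew m (fun i => vanishOff n (n - t) (A i))
    (fun i => vanishOff n (n - t) (B i))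
    (fun i => (vanishOff_disjoint n t _ _).2 (hself i))
    (fun i j hij hd => absurd ((vanishOff_disjoint n t _ _).1 hd) (not_le.2 (hskew i j hij)))
  rw [(Polynomial.degreeLTEquiv ℚ (n - t)).finrank_eq] at h
  simpa using h
end
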